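/- Let K be a number field of degree n = [K:ℚ] over ℚ whose ring of integers 𝓞_K is a principal ideal domain (equivalently, a unique factorization domain), and let d be a squarefree natural number. Then d is realizable over K if and only if φ_K(d) = ∏_{p ∣ d} (p^n − 1), where the product is over all prime divisors p of d in ℤ. -/

import Mathlib

open NumberField

/-- The generalized totient function `φ_K(d)`: the cardinality of the unit group of
`𝓞_K / d𝓞_K`. -/
noncomputable def phiK (K : Type*) [Field K] [NumberField K] (d : ℕ) : ℕ :=
  Nat.card ((𝓞 K ⧸ Ideal.span {(d : 𝓞 K)})ˣ)

/-- A natural number `d` is realizable over `K` if every prime number dividing `d`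
in `ℤ` is an irreducible element of `𝓞_K`. -/
def Realizable (K : Type*) [Field K] [NumberField K] (d : ℕ) : Prop :=
  ∀ p : ℕ, p.Prime → p ∣ d → Irreducible (p : 𝓞 K)

theorem Nat.card_ne_zero_subtype (R : Type*) [Zero R] [Finite R] :
    Nat.card {x : R // x ≠ 0} = Nat.card R - 1 :=
  (Set.ncard_compl ({0} : Set R)).trans (by rw [Set.ncard_singleton])

theorem Units.injective_val_ne_zero (R : Type*) [MonoidWithZero R] [Nontrivial R] :
    Function.Injective (fun u : Rˣ ↦ (⟨u, u.ne_zero⟩ : {x : R // x ≠ 0})) :=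
  fun _ _ h ↦ Units.ext (congrArg Subtype.val h)

theorem Nat.card_units_le_card_sub_one (R : Type*) [CommRing R] [Nontrivial R] [Finite R] :
    Nat.card Rˣ ≤ Nat.card R - 1 := by
  rw [← Nat.card_ne_zero_subtype]
  exact Nat.card_le_card_of_injective _ (Units.injective_val_ne_zero R)

theorem isField_iff_card_units_eq_card_sub_one (R : Type*) [CommRing R] [Nontrivial R]
    [Finite R] : IsField R ↔ Nat.card Rˣ = Nat.card R - 1 := by
  constructor
  · intro h
    let := h.toField
    exact Nat.card_units R
  · intro h
    have hbij := (Nat.bijective_iff_injective_and_card _).2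
      ⟨Units.injective_val_ne_zero R, h.trans (Nat.card_ne_zero_subtype R).symm⟩
    refine ⟨exists_pair_ne R, mul_comm, fun {a} ha ↦ ?_⟩
    obtain ⟨u, hu⟩ := hbij.2 ⟨a, ha⟩
    obtain rfl : (u : R) = a := congrArg Subtype.val hu
    exact ⟨_, u.mul_inv⟩

section

variable (K : Type*) [Field K] [NumberField K]

theorem card_quotient_span_natCast (d : ℕ) :
    Nat.card (𝓞 K ⧸ Ideal.span {(d : 𝓞 K)}) = d ^ Module.finrank ℚ K := by
  rw [← RingOfIntegers.rank, ← Ideal.absNorm_span_natCast, Ideal.absNorm_apply,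
    Submodule.cardQuot_apply]

theorem finite_quotient_span_natCast {d : ℕ} (hd : d ≠ 0) :
    Finite (𝓞 K ⧸ Ideal.span {(d : 𝓞 K)}) := by
  apply Nat.finite_of_card_ne_zero
  rw [card_quotient_span_natCast]
  exact pow_ne_zero _ hd

theorem nontrivial_quotient_span_natCast {d : ℕ} (hd : 1 < d) :
    Nontrivial (𝓞 K ⧸ Ideal.span {(d : 𝓞 K)}) := by
  have := finite_quotient_span_natCast K (d := d) (by omega)
  rw [← Finite.one_lt_card_iff_nontrivial, card_quotient_span_natCast]
  exact Nat.one_lt_pow Module.finrank_pos.ne' hd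

theorem phiK_one : phiK K 1 = 1 := by
  have : Subsingleton (𝓞 K ⧸ Ideal.span {((1 : ℕ) : 𝓞 K)}) := by
    rw [Ideal.Quotient.subsingleton_iff, Nat.cast_one, Ideal.span_singleton_one]
  exact Nat.card_unique

theorem phiK_pos {d : ℕ} (hd : d ≠ 0) : 0 < phiK K d := by
  have := finite_quotient_span_natCast K hd
  exact Nat.card_pos

theorem phiK_mul {a b : ℕ} (h : a.Coprime b) : phiK K (a * b) = phiK K a * phiK K b := by
  have hcop : IsCoprime (Ideal.span {(a : 𝓞 K)}) (Ideal.span {(b : 𝓞 K)}) := by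
    rw [Ideal.isCoprime_span_singleton_iff]
    exact h.cast
  rw [phiK, Nat.cast_mul, ← Ideal.span_singleton_mul_span_singleton,
    Nat.card_congr (Units.mapEquiv
      (Ideal.quotientMulEquivQuotientProd _ _ hcop).toMulEquiv).toEquiv,
    Nat.card_congr MulEquiv.prodUnits.toEquiv, Nat.card_prod]
  rfl

theorem phiK_prod_primes (s : Finset ℕ) (hs : ∀ p ∈ s, p.Prime) :
    phiK K (∏ p ∈ s, p) = ∏ p ∈ s, phiK K p := by
  induction s using Finset.induction_on with
  | empty => simpa using phiK_one K
  | insert p s hp ih =>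
    have hs' : ∀ q ∈ s, q.Prime := fun q hq ↦ hs q (Finset.mem_insert_of_mem hq)
    rw [Finset.prod_insert hp, Finset.prod_insert hp, phiK_mul, ih hs']
    refine Nat.Coprime.prod_right fun q hq ↦ ?_
    rw [Nat.coprime_primes (hs p (Finset.mem_insert_self p s)) (hs' q hq)]
    rintro rfl
    exact hp hq

theorem phiK_le {d : ℕ} (hd : 1 < d) : phiK K d ≤ d ^ Module.finrank ℚ K - 1 := by
  have := finite_quotient_span_natCast K (d := d) (by omega)
  have := nontrivial_quotient_span_natCast K hd
  rw [← card_quotient_span_natCast]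
  exact Nat.card_units_le_card_sub_one _

theorem irreducible_natCast_iff_phiK_eq [IsPrincipalIdealRing (𝓞 K)] {d : ℕ} (hd : 1 < d) :
    Irreducible (d : 𝓞 K) ↔ phiK K d = d ^ Module.finrank ℚ K - 1 := by
  have := finite_quotient_span_natCast K (d := d) (by omega)
  have := nontrivial_quotient_span_natCast K hd
  have hd0 : (d : 𝓞 K) ≠ 0 := Nat.cast_ne_zero.2 (by omega)
  rw [← card_quotient_span_natCast, phiK, ← isField_iff_card_units_eq_card_sub_one,
    ← Ideal.Quotient.maximal_ideal_iff_isField_quotient]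
  constructor
  · exact PrincipalIdealRing.isMaximal_of_irreducible
  · intro h
    exact ((Ideal.span_singleton_prime hd0).1 h.isPrime).irreducible

end

theorem stmt_7 (K : Type*) [Field K] [NumberField K]
    [IsPrincipalIdealRing (𝓞 K)] (d : ℕ) (hd : Squarefree d) :
    Realizable K d ↔
      phiK K d = ∏ p ∈ d.primeFactors, (p ^ (Module.finrank ℚ K) - 1) := by
  have hphi : phiK K d = ∏ p ∈ d.primeFactors, phiK K p := by
    rw [← phiK_prod_primes K _ fun p hp ↦ Nat.prime_of_mem_primeFactors hp,
      Nat.prod_primeFactors_of_squarefree hd]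
  have hlt {p : ℕ} (hp : p ∈ d.primeFactors) : 1 < p := (Nat.prime_of_mem_primeFactors hp).one_lt
  have hreal : Realizable K d ↔
      ∀ p ∈ d.primeFactors, phiK K p = p ^ Module.finrank ℚ K - 1 := by
    constructor
    · intro h p hp
      exact (irreducible_natCast_iff_phiK_eq K (hlt hp)).1
        (h p (Nat.prime_of_mem_primeFactors hp) (Nat.dvd_of_mem_primeFactors hp))
    · intro h p hp hpd
      exact (irreducible_natCast_iff_phiK_eq K hp.one_lt).2
        (h p (Nat.mem_primeFactors.2 ⟨hp, hpd, hd.ne_zero⟩))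
  rw [hreal, hphi]
  refine ⟨Finset.prod_congr rfl, fun h ↦ ?_⟩
  by_contra! hne
  obtain ⟨p, hp, hpne⟩ := hne
  refine h.not_lt (Finset.prod_lt_prod (fun q hq ↦ phiK_pos K (hlt hq).ne_bot)
    (fun q hq ↦ phiK_le K (hlt hq)) ⟨p, hp, (phiK_le K (hlt hp)).lt_of_ne hpne⟩)
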